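/- arXiv:math/0607229 — 3 statements merged into one kernel-verified Lean document; each statement's English description precedes it below -/
import Mathlib

section
/- The complement in S² of any arc A ⊆ S² (a subspace homeomorphic to [0,1]) is path-connected. -/
open Set Topology

/-- A continuous nonvanishing complex function on a simply connected, locally path-connected space
has a continuous logarithm. -/
theorem exists_continuousMap_exp_eq {X : Type*} [TopologicalSpace X] [SimplyConnectedSpace X]
    [LocallyPathConnectedSpace X] (f : C(X, ℂ)) (hf : ∀ x, f x ≠ 0) :
    ∃ g : C(X, ℂ), ∀ x, Complex.exp (g x) = f x := by
  obtain ⟨a⟩ : Nonempty X := inferInstance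
  obtain ⟨g, ⟨-, hg⟩, -⟩ := Complex.isCoveringMapOn_exp.existsUnique_continuousMap_lifts f
    (Complex.exp_log (hf a)) hf
  exact ⟨g, congrFun hg⟩

/-- Every continuous self-map of the plane that is the identity far from the origin vanishes
somewhere. -/
theorem exists_eq_zero_of_eq_id_of_norm_ge {H : ℂ → ℂ} (hH : Continuous H) {R : ℝ} (hR : 0 < R)
    (hid : ∀ z, R ≤ ‖z‖ → H z = z) : ∃ z, H z = 0 := by
  by_contra! hne
  obtain ⟨h, hh⟩ := exists_continuousMap_exp_eq ⟨H, hH⟩ hne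
  replace hh : ∀ z, Complex.exp (h z) = H z := hh
  let γ : ℝ → ℂ := fun t ↦ R * Complex.exp (t * Complex.I)
  have hγ : Continuous γ := by fun_prop
  have hlift : ∀ t, Complex.exp (h (γ t)) = γ t := fun t ↦ by
    rw [hh, hid]
    simp [γ, Complex.norm_exp_ofReal_mul_I, abs_of_pos hR]
  have h0 : γ 0 = R := by simp [γ]
  have heq : (fun t ↦ h (γ t)) = fun t : ℝ ↦ h R + t * Complex.I := by
    refine Complex.isCoveringMap_exp.eq_of_comp_eq (h.continuous.comp hγ) (by fun_prop) ?_ 0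
      (by simp [h0])
    funext t
    have hexpR : Complex.exp (h R) = R := by simpa only [h0] using hlift 0
    exact Subtype.ext (by simp [hlift, Complex.exp_add, hexpR, γ])
  have hperiod := congrFun heq (2 * Real.pi)
  have h2 : γ (2 * Real.pi) = R := by simp [γ]
  simp [h2, Real.pi_ne_zero] at hperiod

/-- If the origin lies in an open set whose union with the closed set `K` is compact, then there is
no continuous logarithm on `K`. -/
theorem not_exists_log_of_mem_of_isCompact_union {K U : Set ℂ} (hK : IsClosed K) (hU : IsOpen U)
    (hKU : IsCompact (K ∪ U)) (h0 : 0 ∈ U) :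
    ¬ ∃ g : C(K, ℂ), ∀ z : K, Complex.exp (g z) = z := by
  classical
  rintro ⟨g, hg⟩
  obtain ⟨G, rfl⟩ := ContinuousMap.exists_restrict_eq hK g
  replace hg : ∀ z ∈ K, Complex.exp (G z) = z := fun z hz ↦ hg ⟨z, hz⟩
  obtain ⟨R, hR, hKR⟩ := hKU.isBounded.subset_ball_lt 0 0
  have hfrontier : frontier (K ∪ U) ⊆ K := fun z hz ↦
    (hKU.isClosed.frontier_subset hz).resolve_right fun hzU ↦
      hz.2 (interior_maximal subset_union_right hU hzU)
  obtain ⟨z, hz⟩ := exists_eq_zero_of_eq_id_of_norm_ge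
    (H := (K ∪ U).piecewise (fun z ↦ Complex.exp (G z)) id)
    (Continuous.piecewise (fun z hz ↦ hg z (hfrontier hz)) (by fun_prop) continuous_id) hR
    (fun z hz ↦ piecewise_eq_of_notMem _ _ _ fun hmem ↦ by
      have := hKR hmem
      simp only [Metric.mem_ball, dist_zero_right] at this
      linarith)
  by_cases hmem : z ∈ K ∪ U
  · rw [piecewise_eq_of_mem _ _ _ hmem] at hz
    exact Complex.exp_ne_zero _ hz
  · rw [piecewise_eq_of_notMem _ _ _ hmem] at hz
    obtain rfl : z = 0 := hz
    exact hmem (Or.inr h0)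

/-- The plane embeds in the sphere as the complement of a given point, with the origin going to
any prescribed other point. -/
theorem exists_isOpenEmbedding_complex_sphere_two
    {p q : Metric.sphere (0 : EuclideanSpace ℝ (Fin 3)) 1} (hpq : p ≠ q) :
    ∃ φ : ℂ → Metric.sphere (0 : EuclideanSpace ℝ (Fin 3)) 1,
      IsOpenEmbedding φ ∧ range φ = {q}ᶜ ∧ φ 0 = p := by
  have : Fact (Module.finrank ℝ (EuclideanSpace ℝ (Fin 3)) = 2 + 1) := ⟨by simp⟩
  let s := (stereographic' 2 q).symm
  have hs : IsOpenEmbedding s := s.isOpenEmbedding (by simp [s])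
  have hrange : range s = {q}ᶜ := by
    rw [← image_univ, ← stereographic'_target q, ← stereographic'_source (n := 2) q]
    exact (stereographic' 2 q).symm_image_target_eq_source
  obtain ⟨x, hx⟩ : p ∈ range s := hrange ▸ hpq
  let e : ℂ ≃ₜ EuclideanSpace ℝ (Fin 2) :=
    Complex.orthonormalBasisOneI.repr.toHomeomorph.trans (Homeomorph.addRight x)
  refine ⟨s ∘ e, hs.comp e.isOpenEmbedding, ?_, ?_⟩
  · rw [e.surjective.range_comp, hrange]
  · simp [e, hx]

/-- An arc does not separate the sphere into two nonempty open pieces. -/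
theorem not_separated_of_arc {A U V : Set (Metric.sphere (0 : EuclideanSpace ℝ (Fin 3)) 1)}
    (e : A ≃ₜ unitInterval) (hU : IsOpen U) (hV : IsOpen V) (hUV : Disjoint U V)
    (hA : Aᶜ = U ∪ V) {p q : Metric.sphere (0 : EuclideanSpace ℝ (Fin 3)) 1}
    (hp : p ∈ U) (hq : q ∈ V) : False := by
  have hcompl : A ∪ U = Vᶜ := by
    ext x
    have hx := Set.ext_iff.1 hA x
    have hxUV : x ∈ U → x ∉ V := fun hxU ↦ disjoint_left.1 hUV hxU
    simp only [mem_compl_iff, mem_union] at hx ⊢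
    tauto
  have hAU : Disjoint A U := disjoint_left.2 fun x hxA hxU ↦
    (hA.symm ▸ Or.inl hxU : x ∈ Aᶜ) hxA
  have hAclosed : IsClosed A := ⟨hA ▸ hU.union hV⟩
  have hqA : q ∉ A := (hA.symm ▸ Or.inr hq : q ∈ Aᶜ)
  obtain ⟨φ, hφ, hrange, hφ0⟩ := exists_isOpenEmbedding_complex_sphere_two
    (hUV.ne_of_mem hp hq)
  have hsub : A ⊆ range φ := fun x hx ↦ hrange ▸ fun h ↦ hqA (h ▸ hx)
  have hcompact : IsCompact (φ ⁻¹' A ∪ φ ⁻¹' U) := by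
    rw [← preimage_union, hcompl]
    rw [hφ.isInducing.isCompact_iff, image_preimage_eq_of_subset]
    · exact hV.isClosed_compl.isCompact
    · exact hrange ▸ compl_subset_compl.2 (singleton_subset_iff.2 hq)
  refine not_exists_log_of_mem_of_isCompact_union (hAclosed.preimage hφ.continuous)
    (hU.preimage hφ.continuous) hcompact
    (mem_preimage.2 (hφ0.symm ▸ hp)) ?_
  choose ψ hψ using fun a : A ↦ hsub a.2
  have hψcont : Continuous ψ := hφ.isInducing.continuous_iff.2 <| by
    simpa only [Function.comp_def, hψ] using continuous_subtype_val
  have hψne : ∀ a, ψ a ≠ 0 := fun a h ↦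
    disjoint_left.1 hAU a.2 (by rw [← hψ a, h, hφ0]; exact hp)
  obtain ⟨g, hg⟩ := exists_continuousMap_exp_eq
    ⟨fun t ↦ ψ (e.symm (projIcc 0 1 zero_le_one t)),
      hψcont.comp (e.symm.continuous.comp continuous_projIcc)⟩ fun t ↦ hψne _
  refine ⟨⟨fun z ↦ g (e ⟨φ z, z.2⟩), g.continuous.comp (continuous_subtype_val.comp
    (e.continuous.comp ((hφ.continuous.comp continuous_subtype_val).subtype_mk _)))⟩,
    fun z ↦ ?_⟩
  refine (hg _).trans (hφ.injective ?_)
  simp [hψ]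

/-- The two-sphere is not an arc. -/
theorem isEmpty_sphere_two_homeomorph_unitInterval :
    IsEmpty (Metric.sphere (0 : EuclideanSpace ℝ (Fin 3)) 1 ≃ₜ unitInterval) := by
  refine ⟨fun e ↦ ?_⟩
  let q := e.symm ⟨1 / 2, by norm_num, by norm_num⟩
  obtain ⟨φ, hφ, hrange, -⟩ := exists_isOpenEmbedding_complex_sphere_two
    (p := e.symm 0) (q := q) (e.symm.injective.ne fun h ↦ by simpa using congrArg Subtype.val h)
  have hpre : IsPreconnected (range fun z ↦ (e (φ z) : ℝ)) :=
    isPreconnected_range (continuous_subtype_val.comp (e.continuous.comp hφ.continuous))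
  have hmem : ∀ t : unitInterval, (t : ℝ) ≠ 1 / 2 → (t : ℝ) ∈ range fun z ↦ (e (φ z) : ℝ) := by
    intro t ht
    obtain ⟨z, hz⟩ : e.symm t ∈ range φ := hrange ▸ e.symm.injective.ne fun h ↦ ht (by rw [h])
    exact ⟨z, by simp [hz]⟩
  obtain ⟨z, hz⟩ := hpre.ordConnected.out (hmem 0 (by norm_num)) (hmem 1 (by norm_num))
    (show (1 / 2 : ℝ) ∈ Icc _ _ by constructor <;> norm_num)
  have hzq : φ z = q := (e.eq_symm_apply).2 (Subtype.ext hz)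
  exact (hrange ▸ mem_range_self z : φ z ∈ ({q}ᶜ : Set _)) hzq

theorem arc_complement_pathConnected_sphere_two
    (A : Set (Metric.sphere (0 : EuclideanSpace ℝ (Fin 3)) 1))
    (hA : Nonempty (A ≃ₜ unitInterval)) :
    IsPathConnected Aᶜ := by
  obtain ⟨e⟩ := hA
  have : Fact (Module.finrank ℝ (EuclideanSpace ℝ (Fin 3)) = 2 + 1) := ⟨by simp⟩
  have : LocallyPathConnectedSpace (Metric.sphere (0 : EuclideanSpace ℝ (Fin 3)) 1) :=
    ChartedSpace.locallyPathConnectedSpace (EuclideanSpace ℝ (Fin 2)) _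
  have hopen : IsOpen Aᶜ := by
    have : CompactSpace A := e.symm.compactSpace
    exact (isCompact_iff_compactSpace.2 this).isClosed.isOpen_compl
  have hne : Aᶜ.Nonempty := by
    rw [nonempty_compl]
    rintro rfl
    exact isEmpty_sphere_two_homeomorph_unitInterval.false ((Homeomorph.Set.univ _).symm.trans e)
  obtain ⟨p, hp⟩ := hne
  refine isPathConnected_iff_eq.2 ⟨p, hp, pathComponentIn_subset.antisymm fun q hq ↦ ?_⟩
  by_contra hqp
  refine not_separated_of_arc e (hopen.pathComponentIn p)
    (V := ⋃ x ∈ Aᶜ \ pathComponentIn Aᶜ p, pathComponentIn Aᶜ x)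
    (isOpen_biUnion fun x _ ↦ hopen.pathComponentIn x) ?_ ?_ (mem_pathComponentIn_self hp)
    (mem_biUnion ⟨hq, hqp⟩ (mem_pathComponentIn_self hq))
  · rw [disjoint_iUnion₂_right]
    refine fun x hx ↦ disjoint_left.2 fun y hyp hyx ↦ hx.2 ?_
    rw [← pathComponentIn_congr hyp, pathComponentIn_congr hyx]
    exact mem_pathComponentIn_self hx.1
  · refine Subset.antisymm (fun x hx ↦ ?_)
      (union_subset pathComponentIn_subset (iUnion₂_subset fun x _ ↦ pathComponentIn_subset))
    by_cases hxp : x ∈ pathComponentIn Aᶜ p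
    · exact Or.inl hxp
    · exact Or.inr (mem_biUnion ⟨hx, hxp⟩ (mem_pathComponentIn_self hx))
end

section
/- (Jordan Separation Theorem) If C is a simple closed curve in S², i.e., a subspace of S² homeomorphic to the circle S¹, then S² \ C is not connected. -/
open Set Filter Topology unitInterval OnePoint

/-- The function `z ↦ (z - a)⁻¹` on the Riemann sphere, with value `0` at infinity. -/
noncomputable def invSub (a : ℂ) (z : OnePoint ℂ) : ℂ :=
  z.elim 0 fun z => (z - a)⁻¹

@[simp] lemma invSub_infty (a : ℂ) : invSub a ∞ = 0 := rfl

@[simp] lemma invSub_coe (a z : ℂ) : invSub a (z : OnePoint ℂ) = (z - a)⁻¹ := rfl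

lemma continuousAt_invSub {a : ℂ} {z : OnePoint ℂ} (hz : z ≠ a) :
    ContinuousAt (invSub a) z := by
  induction z using OnePoint.rec with
  | infty =>
    rw [OnePoint.continuousAt_infty', coclosedCompact_eq_cocompact,
      ← Metric.cobounded_eq_cocompact]
    exact tendsto_inv₀_cobounded.comp (tendsto_sub_const_cobounded a)
  | coe z =>
    rw [OnePoint.continuousAt_coe]
    have hza : z - a ≠ 0 := sub_ne_zero.2 fun h => hz (by rw [h])
    exact (continuousAt_id.sub continuousAt_const).inv₀ hza

/-- The function `z ↦ (z - b) / (z - a)` on the Riemann sphere away from `a`, with value `1` at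
infinity. -/
noncomputable def divSub (a b : ℂ) (z : OnePoint ℂ) : ℂ :=
  1 - (b - a) * invSub a z

lemma divSub_coe {a z : ℂ} (b : ℂ) (hz : z ≠ a) :
    divSub a b (z : OnePoint ℂ) = (z - b) / (z - a) := by
  have := sub_ne_zero.2 hz
  rw [divSub, invSub_coe]
  field_simp
  ring

lemma divSub_ne_zero {a b : ℂ} {z : OnePoint ℂ} (ha : z ≠ a) (hb : z ≠ b) :
    divSub a b z ≠ 0 := by
  induction z using OnePoint.rec with
  | infty => simp [divSub]
  | coe z =>
    rw [Ne, OnePoint.coe_eq_coe] at ha hb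
    rw [divSub_coe b ha]
    exact div_ne_zero (sub_ne_zero.2 hb) (sub_ne_zero.2 ha)

/-- On the complement of a path from `a` to `b` there is a continuous branch of the logarithm of
`(z - b) / (z - a)`. -/
lemma exists_log_divSub_compl_range (γ : C(I, ℂ)) :
    ∃ L : OnePoint ℂ → ℂ, ContinuousOn L ((↑) '' range γ)ᶜ ∧
      ∀ z ∈ ((↑) '' range γ : Set (OnePoint ℂ))ᶜ, Complex.exp (L z) = divSub (γ 0) (γ 1) z := by
  classical
  set A : Set (OnePoint ℂ) := ((↑) '' range γ)ᶜ
  have hA (z : A) (t : I) : (z : OnePoint ℂ) ≠ γ t := fun h =>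
    z.2 (h ▸ mem_image_of_mem _ (mem_range_self t))
  have hinv : Continuous fun z : A => invSub (γ 0) z :=
    continuous_iff_continuousAt.2 fun z =>
      (continuousAt_invSub (hA z 0)).comp continuous_subtype_val.continuousAt
  let H : C(I × A, {w : ℂ // w ≠ 0}) :=
    ⟨fun x => ⟨divSub (γ 0) (γ x.1) x.2, divSub_ne_zero (hA _ _) (hA _ _)⟩, by
      refine Continuous.subtype_mk ?_ _
      have := hinv.comp (continuous_snd (X := I))
      exact continuous_const.sub (Continuous.mul (by fun_prop) this)⟩
  have H_zero (z : A) : H (0, z) = ⟨_, Complex.exp_ne_zero (ContinuousMap.const A (0 : ℂ) z)⟩ :=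
    Subtype.ext (by simp [H, divSub])
  let G := Complex.isCoveringMap_exp.liftHomotopy H (.const A 0) H_zero
  have hG (z : A) : Complex.exp (G (1, z)) = divSub (γ 0) (γ 1) z :=
    congrArg Subtype.val (congrFun (Complex.isCoveringMap_exp.liftHomotopy_lifts H _ H_zero) (1, z))
  refine ⟨fun z => if hz : z ∈ A then G (1, ⟨z, hz⟩) else 0, ?_, fun z hz => ?_⟩
  · rw [continuousOn_iff_continuous_domRestrict]
    have : Continuous fun z : A => G (1, z) := by fun_prop
    convert this with z
    simp [domRestrict]
  · simpa [hz] using hG ⟨z, hz⟩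

/-- Two continuous logarithms of the same function on a preconnected set differ by a constant. -/
lemma IsPreconnected.exists_eqOn_add_of_exp_eq {X : Type*} [TopologicalSpace X] {s : Set X}
    (hs : IsPreconnected s) {f g : X → ℂ} (hf : ContinuousOn f s) (hg : ContinuousOn g s)
    (h : ∀ x ∈ s, Complex.exp (f x) = Complex.exp (g x)) :
    ∃ c : ℂ, Complex.exp c = 1 ∧ EqOn f (fun x => g x + c) s := by
  rcases s.eq_empty_or_nonempty with rfl | ⟨x, hx⟩
  · exact ⟨0, by simp⟩
  · have hc : Complex.exp (f x - g x) = 1 := by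
      rw [Complex.exp_sub, h x hx, div_self (Complex.exp_ne_zero _)]
    refine ⟨f x - g x, hc, Complex.isCoveringMap_exp.eqOn_of_comp_eqOn hs hf
      (hg.add continuousOn_const) (fun y hy => Subtype.ext ?_) hx (by ring)⟩
    simp [Complex.exp_add, hc, h y hy]

/-- Continuous logarithms on two open sets with preconnected intersection can be glued. -/
lemma exists_log_union {X : Type*} [TopologicalSpace X] {U V : Set X} (hU : IsOpen U)
    (hV : IsOpen V) (hUV : IsPreconnected (U ∩ V)) {h f g : X → ℂ} (hf : ContinuousOn f U)
    (hg : ContinuousOn g V) (hfh : ∀ x ∈ U, Complex.exp (f x) = h x)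
    (hgh : ∀ x ∈ V, Complex.exp (g x) = h x) :
    ∃ L : X → ℂ, ContinuousOn L (U ∪ V) ∧ ∀ x ∈ U ∪ V, Complex.exp (L x) = h x := by
  classical
  obtain ⟨c, hc, hfg⟩ := hUV.exists_eqOn_add_of_exp_eq (hf.mono inter_subset_left)
    (hg.mono inter_subset_right) fun x hx => (hfh x hx.1).trans (hgh x hx.2).symm
  have hLU : EqOn (U.piecewise f fun x => g x + c) f U := piecewise_eqOn _ _ _
  have hLV : EqOn (U.piecewise f fun x => g x + c) (fun x => g x + c) V := fun x hx => by
    by_cases hxU : x ∈ U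
    · rw [piecewise_eq_of_mem _ _ _ hxU, hfg ⟨hxU, hx⟩]
    · rw [piecewise_eq_of_notMem _ _ _ hxU]
  refine ⟨_, (hf.congr hLU).union_of_isOpen ((hg.add continuousOn_const).congr hLV) hU hV, ?_⟩
  rintro x (hx | hx)
  · rw [hLU hx, hfh x hx]
  · rw [hLV hx, Complex.exp_add, hc, mul_one, hgh x hx]

/-- There is no continuous branch of the logarithm of `(z - b) / (z - a)` on the Riemann sphere
punctured at `a` and `b`. -/
lemma not_exists_log_divSub {a b : ℂ} (hab : a ≠ b) (L : OnePoint ℂ → ℂ)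
    (hL : ContinuousOn L {(a : OnePoint ℂ), (b : OnePoint ℂ)}ᶜ)
    (hexp : ∀ z ∈ ({(a : OnePoint ℂ), (b : OnePoint ℂ)}ᶜ : Set (OnePoint ℂ)),
      Complex.exp (L z) = divSub a b z) : False := by
  have hba : b - a ≠ 0 := sub_ne_zero.2 hab.symm
  let e : ℝ → ℂ := fun θ => Complex.exp (θ * Complex.I)
  have he : Continuous e := by fun_prop
  have he_norm (θ : ℝ) : ‖e θ‖ = 1 := Complex.norm_exp_ofReal_mul_I θ
  let z : ℝ → ℂ := fun θ => b + (b - a) / 2 * e θ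
  have hz : Continuous z := by fun_prop
  have hslit (θ : ℝ) : 1 + e θ / 2 ∈ Complex.slitPlane :=
    Complex.mem_slitPlane_of_norm_lt_one (by rw [norm_div, he_norm]; norm_num)
  have hza (θ : ℝ) : z θ - a = (b - a) * (1 + e θ / 2) := by simp only [z]; ring
  have hza_ne (θ : ℝ) : z θ ≠ a := by
    rw [← sub_ne_zero, hza]
    exact mul_ne_zero hba (Complex.slitPlane_ne_zero (hslit θ))
  have hzb_ne (θ : ℝ) : z θ ≠ b := by
    rw [← sub_ne_zero]
    simp [z, hba, e]
  have hmem (θ : ℝ) : (z θ : OnePoint ℂ) ∈ ({(a : OnePoint ℂ), (b : OnePoint ℂ)}ᶜ : Set _) := by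
    simp [hza_ne, hzb_ne]
  let G : ℝ → ℂ := fun θ => L (z θ) + Complex.log (1 + e θ / 2)
  have hG : Continuous G :=
    (hL.comp_continuous (OnePoint.continuous_coe.comp hz) hmem).add
      (Continuous.clog (by fun_prop) hslit)
  have hGexp (θ : ℝ) : Complex.exp (G θ) = e θ / 2 := by
    rw [Complex.exp_add, hexp _ (hmem θ), divSub_coe b (hza_ne θ), hza,
      Complex.exp_log (Complex.slitPlane_ne_zero (hslit θ))]
    rw [div_mul_eq_mul_div, mul_div_mul_right _ _ (Complex.slitPlane_ne_zero (hslit θ))]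
    simp only [z]
    field_simp
    ring
  obtain ⟨c, -, hc⟩ := (isPreconnected_univ (α := ℝ)).exists_eqOn_add_of_exp_eq hG.continuousOn
    (g := fun θ => θ * Complex.I + Complex.log (1 / 2)) (by fun_prop) fun θ _ => by
      rw [hGexp, Complex.exp_add, Complex.exp_log (by norm_num)]
      simp only [e]
      ring
  have e_period : e (2 * Real.pi) = e 0 := by simp [e]
  have hG_period : G (2 * Real.pi) = G 0 := by simp only [G, z, e_period]
  rw [hc (mem_univ _), hc (mem_univ _)] at hG_period
  simp [Real.pi_ne_zero] at hG_period

/-- Two paths in the plane with common endpoints that are otherwise disjoint separate the Riemann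
sphere. -/
lemma not_isPreconnected_compl_range_union (γ₁ γ₂ : C(I, ℂ)) (h₀ : γ₂ 0 = γ₁ 0)
    (h₁ : γ₂ 1 = γ₁ 1) (hne : γ₁ 0 ≠ γ₁ 1) (hinter : range γ₁ ∩ range γ₂ ⊆ {γ₁ 0, γ₁ 1}) :
    ¬ IsPreconnected ((↑) '' (range γ₁ ∪ range γ₂) : Set (OnePoint ℂ))ᶜ := by
  intro hpre
  obtain ⟨f, hf, hfexp⟩ := exists_log_divSub_compl_range γ₁
  obtain ⟨g, hg, hgexp⟩ := exists_log_divSub_compl_range γ₂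
  rw [h₀, h₁] at hgexp
  have hopen (γ : C(I, ℂ)) : IsOpen ((↑) '' range γ : Set (OnePoint ℂ))ᶜ :=
    ((isCompact_range γ.continuous).image OnePoint.continuous_coe).isClosed.isOpen_compl
  rw [image_union, compl_union] at hpre
  obtain ⟨L, hL, hLexp⟩ := exists_log_union (hopen γ₁) (hopen γ₂) hpre hf hg hfexp hgexp
  have hsub : ({(γ₁ 0 : OnePoint ℂ), (γ₁ 1 : OnePoint ℂ)}ᶜ : Set (OnePoint ℂ)) ⊆
      ((↑) '' range γ₁)ᶜ ∪ ((↑) '' range γ₂)ᶜ := by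
    rw [← compl_inter, compl_subset_compl, ← image_inter OnePoint.coe_injective, ← image_pair]
    exact image_mono hinter
  exact not_exists_log_divSub hne L (hL.mono hsub) fun z hz => hLexp z (hsub hz)

/-- The Riemann sphere is homeomorphic to `S²`, with infinity sent to any prescribed point. -/
lemma exists_homeomorph_sphere_infty (v : Metric.sphere (0 : EuclideanSpace ℝ (Fin 3)) 1) :
    ∃ Φ : OnePoint ℂ ≃ₜ Metric.sphere (0 : EuclideanSpace ℝ (Fin 3)) 1, Φ ∞ = v := by
  have hv : ‖(v : EuclideanSpace ℝ (Fin 3))‖ = 1 := norm_eq_of_mem_sphere v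
  have : Fact (Module.finrank ℝ (EuclideanSpace ℝ (Fin 3)) = 2 + 1) := ⟨by simp⟩
  have hfin : Module.finrank ℝ ℂ = Module.finrank ℝ (Submodule.span ℝ {v.1})ᗮ := by
    rw [Complex.finrank_real_complex]
    exact (Submodule.finrank_orthogonal_span_singleton (ne_zero_of_mem_unit_sphere v)).symm
  let e : ℂ ≃ₜ (Submodule.span ℝ {v.1})ᗮ :=
    (FiniteDimensional.nonempty_continuousLinearEquiv_of_finrank_eq hfin).some.toHomeomorph
  exact ⟨e.onePointCongr.trans (onePointHyperplaneHomeoUnitSphere hv), rfl⟩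

lemma eq_one_or_eq_neg_one_of_norm_eq_one_of_im_eq_zero {z : ℂ} (hz : ‖z‖ = 1)
    (him : z.im = 0) : z = 1 ∨ z = -1 := by
  have hre : |z.re| = 1 := (Complex.abs_re_eq_norm.2 him).trans hz
  refine (eq_or_eq_neg_of_abs_eq hre).imp (fun h => ?_) fun h => ?_ <;>
    exact Complex.ext (by simp [h]) (by simp [him])

lemma isEmpty_onePoint_homeomorph_circle :
    IsEmpty (OnePoint ℂ ≃ₜ Metric.sphere (0 : ℂ) 1) := by
  refine ⟨fun e => ?_⟩
  obtain ⟨p, hp⟩ : ∃ p : ℂ, (p : OnePoint ℂ) = e.symm (-e ∞) := by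
    rw [← OnePoint.ne_infty_iff_exists, Ne, e.symm_apply_eq]
    exact (ne_neg_of_mem_unit_sphere ℝ (e ∞)).symm
  have hep : e p = -e ∞ := by rw [hp, e.apply_symm_apply]
  set u : ℂ := (e ∞ : ℂ)
  have hu : ‖u‖ = 1 := norm_eq_of_mem_sphere (e ∞)
  have hu₀ : u ≠ 0 := ne_zero_of_mem_unit_sphere (e ∞)
  have hconn : IsPreconnected ({p}ᶜ : Set ℂ) :=
    (isConnected_compl_singleton_of_one_lt_rank (by simp) p).isPreconnected
  have him : IsPreconnected ((fun w : ℂ => ((e w : ℂ) / u).im) '' {p}ᶜ) :=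
    hconn.image _ (by
      have := e.continuous.comp OnePoint.continuous_coe
      exact (Complex.continuous_im.comp
        ((continuous_subtype_val.comp this).div_const u)).continuousOn)
  have hval (y : ℂ) (hy : ‖y‖ = 1) (hy1 : y ≠ 1) (hy2 : y ≠ -1) :
      y.im ∈ (fun w : ℂ => ((e w : ℂ) / u).im) '' {p}ᶜ := by
    have hyu : y * u ∈ Metric.sphere (0 : ℂ) 1 := by simp [hy, hu]
    obtain ⟨w, hw⟩ : ∃ w : ℂ, (w : OnePoint ℂ) = e.symm ⟨y * u, hyu⟩ := by
      rw [← OnePoint.ne_infty_iff_exists, Ne, e.symm_apply_eq]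
      intro h
      exact hy1 (mul_right_cancel₀ hu₀ ((congrArg Subtype.val h).trans (one_mul u).symm))
    have hew : (e w : ℂ) = y * u := by rw [hw, e.apply_symm_apply]
    refine ⟨w, ?_, by simp only [hew, mul_div_cancel_right₀ _ hu₀]⟩
    rintro rfl
    rw [hep] at hew
    exact hy2 (mul_right_cancel₀ hu₀ (hew.symm.trans (by simp [u])))
  have hI : (1 : ℝ) ∈ (fun w : ℂ => ((e w : ℂ) / u).im) '' {p}ᶜ :=
    hval Complex.I (by simp) (fun h => by simpa using congrArg Complex.im h)
      (fun h => by simpa using congrArg Complex.im h)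
  have hnegI : (-1 : ℝ) ∈ (fun w : ℂ => ((e w : ℂ) / u).im) '' {p}ᶜ := by
    simpa using hval (-Complex.I) (by simp) (fun h => by simpa using congrArg Complex.im h)
      (fun h => by simpa using congrArg Complex.im h)
  obtain ⟨w, hwp, hw⟩ := him.ordConnected.out hnegI hI (show (0 : ℝ) ∈ Icc (-1) 1 by simp)
  rcases eq_one_or_eq_neg_one_of_norm_eq_one_of_im_eq_zero (z := (e w : ℂ) / u)
    (by simp [hu]) hw with h | h <;> rw [div_eq_iff hu₀] at h
  · exact OnePoint.coe_ne_infty w (e.injective (Subtype.ext (h.trans (one_mul u))))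
  · refine hwp (OnePoint.coe_injective (e.injective (Subtype.ext ?_)))
    rw [h, hep]
    simp [u]

/-- The circle is the union of two arcs meeting exactly at their common endpoints. -/
lemma exists_circle_arcs :
    ∃ α β : C(I, Metric.sphere (0 : ℂ) 1), β 0 = α 0 ∧ β 1 = α 1 ∧ α 0 ≠ α 1 ∧
      range α ∩ range β ⊆ {α 0, α 1} ∧ range α ∪ range β = univ := by
  have key (ε : ℝ) : ∃ α : C(I, Metric.sphere (0 : ℂ) 1),
      ∀ t, (α t : ℂ) = Complex.exp ((ε * (Real.pi * t) : ℝ) * Complex.I) :=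
    ⟨⟨fun t => ⟨Complex.exp ((ε * (Real.pi * t) : ℝ) * Complex.I),
      mem_sphere_zero_iff_norm.2 (Complex.norm_exp_ofReal_mul_I _)⟩, by fun_prop⟩, fun t => rfl⟩
  obtain ⟨α, hα⟩ := key 1
  obtain ⟨β, hβ⟩ := key (-1)
  have hα₀ : (α 0 : ℂ) = 1 := by simp [hα]
  have hβ₀ : (β 0 : ℂ) = 1 := by simp [hβ]
  have hα₁ : (α 1 : ℂ) = -1 := by simp [hα]
  have hβ₁ : (β 1 : ℂ) = -1 := by simp [hβ, Complex.exp_neg]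
  have hsin (t : I) : 0 ≤ Real.sin (Real.pi * t) :=
    Real.sin_nonneg_of_nonneg_of_le_pi (mul_nonneg Real.pi_pos.le t.2.1)
      (mul_le_of_le_one_right Real.pi_pos.le t.2.2)
  refine ⟨α, β, Subtype.ext (hβ₀.trans hα₀.symm), Subtype.ext (hβ₁.trans hα₁.symm), fun h => ?_,
    ?_, ?_⟩
  · have := congrArg Subtype.val h
    rw [hα₀, hα₁] at this
    norm_num at this
  · rintro c ⟨⟨t, rfl⟩, s, hs⟩
    have ht_im : 0 ≤ (α t : ℂ).im := by
      rw [hα, Complex.exp_ofReal_mul_I_im, one_mul]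
      exact hsin t
    have hs_im : (α t : ℂ).im ≤ 0 := by
      rw [← hs, hβ, Complex.exp_ofReal_mul_I_im, neg_one_mul, Real.sin_neg]
      exact neg_nonpos.2 (hsin s)
    rcases eq_one_or_eq_neg_one_of_norm_eq_one_of_im_eq_zero
      (norm_eq_of_mem_sphere (α t)) (hs_im.antisymm ht_im) with h | h
    · exact Or.inl (Subtype.ext (h.trans hα₀.symm))
    · exact Or.inr (Subtype.ext (h.trans hα₁.symm))
  · refine eq_univ_of_forall fun c => ?_
    have hc : Complex.exp ((c : ℂ).arg * Complex.I) = c := by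
      simpa using Complex.norm_mul_exp_arg_mul_I (c : ℂ)
    have ht : |(c : ℂ).arg| / Real.pi ∈ I :=
      ⟨by positivity, div_le_one_of_le₀ (Complex.abs_arg_le_pi _) Real.pi_pos.le⟩
    have hmul : Real.pi * (|(c : ℂ).arg| / Real.pi) = |(c : ℂ).arg| :=
      mul_div_cancel₀ _ Real.pi_ne_zero
    rcases le_total 0 (c : ℂ).arg with h | h
    · refine Or.inl ⟨⟨_, ht⟩, Subtype.ext ?_⟩
      rw [hα, hmul, abs_of_nonneg h, one_mul, hc]
    · refine Or.inr ⟨⟨_, ht⟩, Subtype.ext ?_⟩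
      rw [hβ, hmul, abs_of_nonpos h, neg_one_mul, neg_neg, hc]

/-- The Jordan Separation Theorem: the complement of a simple closed curve in `S²`
is not connected. -/
theorem jordan_separation
    (C : Set (Metric.sphere (0 : EuclideanSpace ℝ (Fin 3)) 1))
    (hC : Nonempty (C ≃ₜ Metric.sphere (0 : ℂ) 1)) :
    ¬ IsPreconnected Cᶜ := by
  obtain ⟨e⟩ := hC
  by_cases hCuniv : C = univ
  · subst hCuniv
    obtain ⟨v⟩ : Nonempty (Metric.sphere (0 : EuclideanSpace ℝ (Fin 3)) 1) :=
      (NormedSpace.sphere_nonempty.2 zero_le_one).to_subtype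
    obtain ⟨Φ, -⟩ := exists_homeomorph_sphere_infty v
    exact (isEmpty_onePoint_homeomorph_circle.false
      (Φ.trans ((Homeomorph.Set.univ _).symm.trans e))).elim
  obtain ⟨v, hv⟩ := (ne_univ_iff_exists_notMem C).1 hCuniv
  obtain ⟨Φ, hΦ⟩ := exists_homeomorph_sphere_infty v
  have hfinite (c : Metric.sphere (0 : ℂ) 1) :
      ∃ z : ℂ, (z : OnePoint ℂ) = Φ.symm (e.symm c) := by
    rw [← OnePoint.ne_infty_iff_exists, Ne, Φ.symm_apply_eq, hΦ]
    exact fun h => hv (h ▸ (e.symm c).2)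
  choose ζ hζ using hfinite
  have hζ_cont : Continuous ζ := by
    rw [OnePoint.isOpenEmbedding_coe.isInducing.continuous_iff]
    exact (Φ.symm.continuous.comp (continuous_subtype_val.comp e.symm.continuous)).congr
      fun c => (hζ c).symm
  have hζ_inj : Function.Injective ζ := fun c d h =>
    e.symm.injective (Subtype.ext (Φ.symm.injective (by rw [← hζ, ← hζ, h])))
  have hζ_range : ((↑) '' range ζ : Set (OnePoint ℂ)) = Φ.symm '' C := by
    rw [← range_comp, show ((↑) ∘ ζ : _ → OnePoint ℂ) = Φ.symm ∘ Subtype.val ∘ e.symm from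
      funext hζ, range_comp, range_comp, e.symm.surjective.range_eq, image_univ,
      Subtype.range_coe]
  obtain ⟨α, β, h₀, h₁, hne, hinter, hunion⟩ := exists_circle_arcs
  let s : C(Metric.sphere (0 : ℂ) 1, ℂ) := ⟨ζ, hζ_cont⟩
  have hsep := not_isPreconnected_compl_range_union (s.comp α) (s.comp β)
    (congrArg ζ h₀) (congrArg ζ h₁) (hζ_inj.ne hne) (by
      simp only [ContinuousMap.coe_comp, range_comp, s, ContinuousMap.coe_mk,
        ContinuousMap.comp_apply]
      rw [← image_inter hζ_inj, ← image_pair]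
      exact image_mono hinter)
  simp only [ContinuousMap.coe_comp, range_comp, s, ContinuousMap.coe_mk] at hsep
  rw [← image_union, hunion, image_univ, hζ_range, ← image_compl_eq Φ.symm.bijective] at hsep
  exact fun h => hsep (h.image _ Φ.symm.continuous.continuousOn)
end

section
/- (Jordan Curve Theorem on the sphere) If C is a simple closed curve in S², then S² \ C has exactly two connected components, and each component P satisfies: the frontier of P (i.e., closure of P minus P) equals C. -/
/-- A nowhere vanishing homotopy with a continuous logarithm at time `0` has one at time `1`. -/
theorem exists_continuous_log_of_homotopy {A : Type*} [TopologicalSpace A]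
    {H : unitInterval × A → ℂ} (hH : Continuous H) (hH0 : ∀ x, H x ≠ 0)
    {f : A → ℂ} (hf : Continuous f) (hfH : ∀ a, Complex.exp (f a) = H (0, a)) :
    ∃ g : A → ℂ, Continuous g ∧ ∀ a, Complex.exp (g a) = H (1, a) := by
  let H' : C(unitInterval × A, {z : ℂ // z ≠ 0}) := ⟨fun x ↦ ⟨H x, hH0 x⟩, by fun_prop⟩
  have h0 : ∀ a, H' (0, a) = ⟨_, ((⟨f, hf⟩ : C(A, ℂ)) a).exp_ne_zero⟩ :=
    fun a ↦ Subtype.ext (hfH a).symm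
  refine ⟨fun a ↦ Complex.isCoveringMap_exp.liftHomotopy H' ⟨f, hf⟩ h0 (1, a), by fun_prop,
    fun a ↦ ?_⟩
  exact congrArg Subtype.val
    (congrFun (Complex.isCoveringMap_exp.liftHomotopy_lifts H' ⟨f, hf⟩ h0) (1, a))

/-- Nowhere vanishing continuous functions on a real normed space have continuous logarithms. -/
theorem exists_continuous_log {E : Type*} [NormedAddCommGroup E] [NormedSpace ℝ E]
    {h : E → ℂ} (hh : Continuous h) (hh0 : ∀ x, h x ≠ 0) :
    ∃ g : E → ℂ, Continuous g ∧ ∀ a, Complex.exp (g a) = h a := by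
  obtain ⟨g, hg, hgh⟩ := exists_continuous_log_of_homotopy (A := E)
    (H := fun x ↦ h ((x.1 : ℝ) • x.2)) (by fun_prop) (fun x ↦ hh0 _)
    (f := fun _ ↦ Complex.log (h 0)) continuous_const
    (fun a ↦ by simp [Complex.exp_log (hh0 0)])
  exact ⟨g, hg, fun a ↦ by simpa using hgh a⟩

/-- Two continuous logarithms on a preconnected space differ by a constant in `2πiℤ`. -/
theorem exists_int_of_exp_eq_exp {X : Type*} [TopologicalSpace X] [PreconnectedSpace X]
    {f g : X → ℂ} (hf : Continuous f) (hg : Continuous g)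
    (h : ∀ x, Complex.exp (f x) = Complex.exp (g x)) :
    ∃ n : ℤ, ∀ x, f x = g x + n * (2 * Real.pi * Complex.I) := by
  rcases isEmpty_or_nonempty X with hX | ⟨⟨x₀⟩⟩
  · exact ⟨0, fun x ↦ (hX.false x).elim⟩
  obtain ⟨n, hn⟩ := Complex.exp_eq_exp_iff_exists_int.1 (h x₀)
  refine ⟨n, congrFun (Complex.isCoveringMap_exp.eq_of_comp_eq hf
    (g₂ := fun x ↦ g x + n * (2 * Real.pi * Complex.I)) (by fun_prop) ?_ x₀ hn)⟩
  funext x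
  exact Subtype.ext ((h x).trans (Complex.exp_eq_exp_iff_exists_int.2 ⟨-n, by push_cast; ring⟩))

theorem eq_zero_of_exp_eq_zpow_on_sphere {p : ℂ} {r : ℝ} (hr : 0 < r) {m : ℤ} {f : ℂ → ℂ}
    (hf : ContinuousOn f (Metric.sphere p r))
    (h : ∀ z ∈ Metric.sphere p r, Complex.exp (f z) = (z - p) ^ m) : m = 0 := by
  have hmem : ∀ t : ℝ, circleMap p r t ∈ Metric.sphere p r := circleMap_mem_sphere p hr.le
  obtain ⟨n, hn⟩ := exists_int_of_exp_eq_exp (X := ℝ) (f := fun t ↦ f (circleMap p r t))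
    (g := fun t : ℝ ↦ m * (Real.log r + t * Complex.I))
    (hf.comp_continuous (continuous_circleMap p r) hmem) (by fun_prop) (fun t ↦ by
      rw [h _ (hmem t), Complex.exp_int_mul, Complex.exp_add, ← Complex.ofReal_exp,
        Real.exp_log hr]
      simp [circleMap])
  have h0 := hn 0
  have h1 := hn (2 * Real.pi)
  have hper : circleMap p r (2 * Real.pi) = circleMap p r 0 := by
    simpa using periodic_circleMap p r 0
  simp only [hper] at h1
  rw [h0] at h1
  have h2 : (m : ℂ) * (2 * Real.pi * Complex.I) = 0 := by
    push_cast at h1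
    linear_combination -h1
  simpa [Real.pi_ne_zero] using h2

/-- On a bounded open set, no nowhere vanishing function has the boundary values of `(z - p) ^ m`
with `p` in the set and `m ≠ 0`. -/
theorem eq_zero_of_extends_zpow {P : Set ℂ} (hP : IsOpen P) (hb : Bornology.IsBounded P) {p : ℂ}
    (hp : p ∈ P) {m : ℤ} {G : ℂ → ℂ} (hG : ContinuousOn G (closure P))
    (hG0 : ∀ z ∈ closure P, G z ≠ 0) (hGp : ∀ z ∈ frontier P, G z = (z - p) ^ m) : m = 0 := by
  classical
  have hne : ∀ z ∉ P, z - p ≠ 0 := fun z hz h ↦ hz (by rwa [sub_eq_zero.1 h])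
  have hcont : Continuous (P.piecewise G fun z ↦ (z - p) ^ m) := by
    refine continuous_piecewise hGp hG fun z hz ↦ ?_
    rw [hP.isClosed_compl.closure_eq] at hz
    have h1 : ContinuousAt (fun w ↦ w - p) z := by fun_prop
    exact (h1.zpow₀ m (.inl (hne z hz))).continuousWithinAt
  obtain ⟨f, hf, hfe⟩ := exists_continuous_log hcont (fun z ↦ by
    by_cases hz : z ∈ P
    · simpa [hz] using hG0 z (subset_closure hz)
    · simpa [hz] using zpow_ne_zero m (hne z hz))
  obtain ⟨r, hr0, hr⟩ := hb.subset_ball_lt 0 p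
  refine eq_zero_of_exp_eq_zpow_on_sphere hr0 hf.continuousOn (p := p) (m := m) fun z hz ↦ ?_
  have hzP : z ∉ P := fun h ↦ by
    have h1 := hr h
    rw [Metric.mem_ball] at h1
    rw [Metric.mem_sphere] at hz
    exact h1.ne hz
  rw [hfe, Set.piecewise_eq_of_notMem _ _ _ hzP]

theorem isPreconnected_setOf_lt_norm {R : ℝ} (hR : 0 < R) :
    IsPreconnected {z : ℂ | R < ‖z‖} := by
  have h : {z : ℂ | R < ‖z‖} = Complex.exp '' {w : ℂ | Real.log R < w.re} := by
    ext z
    constructor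
    · intro hz
      have hz0 : 0 < ‖z‖ := hR.trans hz
      refine ⟨Complex.log z, ?_, Complex.exp_log (norm_pos_iff.1 hz0)⟩
      rw [Set.mem_ofPred_eq, Complex.log_re]
      exact Real.log_lt_log hR hz
    · rintro ⟨w, hw, rfl⟩
      rw [Set.mem_ofPred_eq, Complex.norm_exp]
      exact (Real.log_lt_iff_lt_exp hR).1 hw
  rw [h]
  exact (convex_halfSpace_re_gt _).isPreconnected.image _ Complex.continuous_exp.continuousOn

section Components

variable {K : Set ℂ}

theorem closure_connectedComponentIn_inter_subset (hK : IsClosed K) (x : ℂ) :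
    closure (connectedComponentIn Kᶜ x) ∩ Kᶜ ⊆ connectedComponentIn Kᶜ x := by
  rintro z ⟨hz, hzK⟩
  obtain ⟨y, hyz, hyx⟩ := mem_closure_iff.1 hz _ (hK.isOpen_compl.connectedComponentIn (x := z))
    (mem_connectedComponentIn hzK)
  rw [connectedComponentIn_eq hyx, ← connectedComponentIn_eq hyz]
  exact mem_connectedComponentIn hzK

theorem frontier_connectedComponentIn_subset (hK : IsClosed K) (x : ℂ) :
    frontier (connectedComponentIn Kᶜ x) ⊆ K := by
  intro z hz
  rw [hK.isOpen_compl.connectedComponentIn.frontier_eq] at hz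
  by_contra hzK
  exact hz.2 (closure_connectedComponentIn_inter_subset hK x ⟨hz.1, hzK⟩)

theorem connectedComponentIn_eq_of_not_isBounded (hK : IsCompact K) {x y : ℂ}
    (hx : ¬ Bornology.IsBounded (connectedComponentIn Kᶜ x))
    (hy : ¬ Bornology.IsBounded (connectedComponentIn Kᶜ y)) :
    connectedComponentIn Kᶜ x = connectedComponentIn Kᶜ y := by
  obtain ⟨R, hR0, hR⟩ := hK.isBounded.subset_closedBall_lt 0 0
  have hsub : {z : ℂ | R < ‖z‖} ⊆ Kᶜ := fun z hz hzK ↦ by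
    have := hR hzK
    rw [mem_closedBall_zero_iff] at this
    exact absurd this (not_le.2 hz)
  have key : ∀ w, ¬ Bornology.IsBounded (connectedComponentIn Kᶜ w) →
      ∃ z, R < ‖z‖ ∧ z ∈ connectedComponentIn Kᶜ w := by
    intro w hw
    by_contra! hcon
    refine hw ((Metric.isBounded_closedBall (x := (0 : ℂ)) (r := R)).subset fun z hz ↦ ?_)
    rw [mem_closedBall_zero_iff]
    by_contra hlt
    exact hcon z (not_le.1 hlt) hz
  obtain ⟨a, ha, hax⟩ := key x hx
  obtain ⟨b, hb, hby⟩ := key y hy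
  rw [connectedComponentIn_eq hax, connectedComponentIn_eq hby]
  exact connectedComponentIn_eq
    ((isPreconnected_setOf_lt_norm hR0).subset_connectedComponentIn ha hsub hb)

theorem isPreconnected_compl_of_forall_not_isBounded (hK : IsCompact K)
    (h : ∀ x ∈ Kᶜ, ¬ Bornology.IsBounded (connectedComponentIn Kᶜ x)) : IsPreconnected Kᶜ := by
  refine isPreconnected_of_forall_pair fun x hx y hy ↦
    ⟨connectedComponentIn Kᶜ x, connectedComponentIn_subset _ _, mem_connectedComponentIn hx, ?_,
      isPreconnected_connectedComponentIn⟩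
  rw [connectedComponentIn_eq_of_not_isBounded hK (h x hx) (h y hy)]
  exact mem_connectedComponentIn hy

theorem eq_zero_of_isBounded_connectedComponentIn (hK : IsClosed K) {p : ℂ} (hp : p ∈ Kᶜ)
    (hb : Bornology.IsBounded (connectedComponentIn Kᶜ p)) {m : ℤ} {G : ℂ → ℂ}
    (hG : ContinuousOn G (closure (connectedComponentIn Kᶜ p)))
    (hG0 : ∀ z ∈ closure (connectedComponentIn Kᶜ p), G z ≠ 0)
    (hGp : ∀ z ∈ K, G z = (z - p) ^ m) : m = 0 :=
  eq_zero_of_extends_zpow hK.isOpen_compl.connectedComponentIn hb (mem_connectedComponentIn hp) hG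
    hG0 fun z hz ↦ hGp z (frontier_connectedComponentIn_subset hK p hz)

end Components

/-- An arc in the plane does not separate the plane. -/
theorem isPreconnected_compl_arc {c : ℝ → ℂ} (hc : Continuous c) {s t : ℝ} (hst : s ≤ t)
    (hinj : Set.InjOn c (Set.Icc s t)) : IsPreconnected (c '' Set.Icc s t)ᶜ := by
  have hK : IsCompact (c '' Set.Icc s t) := isCompact_Icc.image hc
  refine isPreconnected_compl_of_forall_not_isBounded hK fun p hp hb ↦ ?_
  have he : Topology.IsClosedEmbedding (fun u : Set.Icc s t ↦ c u) :=
    (hc.comp continuous_subtype_val).isClosedEmbedding hinj.injective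
  obtain ⟨F, hF, hFe⟩ := exists_continuous_log (E := ℝ)
    (h := fun u ↦ c (Set.projIcc s t hst u) - p) (by fun_prop)
    (fun u h ↦ hp ⟨_, (Set.projIcc s t hst u).2, sub_eq_zero.1 h⟩)
  obtain ⟨g, hg⟩ := ContinuousMap.exists_extension' he
    (⟨fun u ↦ F u, by fun_prop⟩ : C(Set.Icc s t, ℂ))
  refine one_ne_zero (eq_zero_of_isBounded_connectedComponentIn hK.isClosed hp hb (m := 1)
    (G := fun z ↦ Complex.exp (g z)) (by fun_prop) (fun z _ ↦ Complex.exp_ne_zero _) ?_)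
  rintro _ ⟨u, hu, rfl⟩
  have h1 : g (c u) = F u := congrFun hg ⟨u, hu⟩
  rw [h1, hFe, Set.projIcc_of_mem hst hu, zpow_one]

section HalfArcs

variable {X : Type*} {c : ℝ → X}

theorem compl_image_inter_compl_image (hinj : ∀ s t, c s = c t ↔ ∃ n : ℤ, s = t + n) :
    (c '' Set.Icc 0 (1 / 2))ᶜ ∩ (c '' Set.Icc (1 / 2) 1)ᶜ = (Set.range c)ᶜ := by
  have hper : Function.Periodic c 1 := fun t ↦ (hinj _ _).2 ⟨1, by simp⟩
  rw [← Set.compl_union, ← Set.image_union,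
    Set.Icc_union_Icc_eq_Icc (by norm_num) (by norm_num)]
  simpa using congrArg compl (hper.image_Icc one_pos 0)

theorem compl_pair_subset_union (hinj : ∀ s t, c s = c t ↔ ∃ n : ℤ, s = t + n) :
    {c 0, c (1 / 2)}ᶜ ⊆ (c '' Set.Icc 0 (1 / 2))ᶜ ∪ (c '' Set.Icc (1 / 2) 1)ᶜ := by
  rw [← Set.compl_inter, Set.compl_subset_compl]
  rintro _ ⟨⟨s, hs, rfl⟩, ⟨t, ht, hst⟩⟩
  obtain ⟨n, hn⟩ := (hinj _ _).1 hst
  have hn0 : (-1 : ℝ) < n := by linarith [hs.2, ht.1]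
  have hn1 : (n : ℝ) < 2 := by linarith [hs.1, ht.2]
  have hn2 : -1 < n := by exact_mod_cast hn0
  have hn3 : n < 2 := by exact_mod_cast hn1
  obtain rfl | rfl : n = 0 ∨ n = 1 := by omega
  · right
    have : s = 1 / 2 := by push_cast at hn; linarith [hs.2, ht.1]
    rw [this]; rfl
  · left
    have : s = 0 := by push_cast at hn; linarith [hs.1, ht.2]
    rw [this]

/-- A simple closed curve filling the whole space is disconnected by removing two points. -/
theorem not_isPreconnected_compl_pair [TopologicalSpace X] [T2Space X] (hc : Continuous c)
    (hinj : ∀ s t, c s = c t ↔ ∃ n : ℤ, s = t + n) (hsurj : Set.range c = Set.univ) :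
    ¬ IsPreconnected ({c 0, c (1 / 2)}ᶜ : Set X) := by
  intro hpre
  have hne : ∀ s t, -1 < s - t → s - t < 1 → s ≠ t → c s ≠ c t := by
    intro s t h1 h2 hst h
    obtain ⟨n, hn⟩ := (hinj _ _).1 h
    have h3 : -1 < n := by
      have : (-1 : ℝ) < n := by linarith
      exact_mod_cast this
    have h4 : n < 1 := by
      have : (n : ℝ) < 1 := by linarith
      exact_mod_cast this
    obtain rfl : n = 0 := by omega
    exact hst (by simpa using hn)
  have hpair : ∀ u, 0 < u → u < 1 → u ≠ 1 / 2 → c u ∈ ({c 0, c (1 / 2)}ᶜ : Set X) := by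
    rintro u h0 h1 h2 (h | h)
    · exact hne _ _ (by linarith) (by linarith) h0.ne' h
    · exact hne _ _ (by linarith) (by linarith) h2 h
  have hU : c (3 / 4) ∈ (c '' Set.Icc 0 (1 / 2))ᶜ := by
    rintro ⟨u, hu, h⟩
    exact hne _ _ (by linarith [hu.1]) (by linarith [hu.2]) (by linarith [hu.2]) h
  have hV : c (1 / 4) ∈ (c '' Set.Icc (1 / 2) 1)ᶜ := by
    rintro ⟨u, hu, h⟩
    exact hne _ _ (by linarith [hu.1]) (by linarith [hu.2]) (by linarith [hu.1]) h
  obtain ⟨z, -, hz⟩ := hpre _ _ (isCompact_Icc.image hc).isClosed.isOpen_compl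
    (isCompact_Icc.image hc).isClosed.isOpen_compl (compl_pair_subset_union hinj)
    ⟨_, hpair (3 / 4) (by norm_num) (by norm_num) (by norm_num), hU⟩
    ⟨_, hpair (1 / 4) (by norm_num) (by norm_num) (by norm_num), hV⟩
  rw [compl_image_inter_compl_image hinj, hsurj, Set.compl_univ] at hz
  exact hz

end HalfArcs

section ClosedCurve

variable {c : ℝ → ℂ}

theorem exists_continuous_log_comp_periodic (hc : Continuous c) (hper : Function.Periodic c 1)
    {p : ℂ} (hp : p ∉ Set.range c) :
    ∃ (d : ℤ) (F : ℝ → ℂ), Continuous F ∧ (∀ t, Complex.exp (F t) = c t - p) ∧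
      ∀ t, F (t + 1) = F t + d * (2 * Real.pi * Complex.I) := by
  obtain ⟨F, hF, hFe⟩ := exists_continuous_log (E := ℝ) (h := fun u ↦ c u - p) (by fun_prop)
    (fun u h ↦ hp ⟨u, sub_eq_zero.1 h⟩)
  obtain ⟨d, hd⟩ := exists_int_of_exp_eq_exp (f := fun t ↦ F (t + 1)) (g := F) (by fun_prop) hF
    (fun t ↦ by rw [hFe, hFe, hper])
  exact ⟨d, F, hF, hFe, hd⟩

theorem isCompact_range_of_periodic (hc : Continuous c) (hper : Function.Periodic c 1) :
    IsCompact (Set.range c) := by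
  rw [← hper.image_Icc one_pos 0]
  exact isCompact_Icc.image hc

/-- A continuous function on a simple closed curve extends continuously to the plane. -/
theorem exists_continuous_extension_of_periodic (hc : Continuous c)
    (hinj : ∀ s t, c s = c t ↔ ∃ n : ℤ, s = t + n) {F : ℝ → ℂ} (hF : Continuous F)
    (hFper : Function.Periodic F 1) :
    ∃ g : ℂ → ℂ, Continuous g ∧ ∀ t, g (c t) = F t := by
  have hper : Function.Periodic c 1 := fun t ↦ (hinj _ _).2 ⟨1, by simp⟩
  have : Fact ((0 : ℝ) < 1) := ⟨one_pos⟩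
  have he : Topology.IsClosedEmbedding (hper.lift : AddCircle (1 : ℝ) → ℂ) := by
    refine Continuous.isClosedEmbedding (continuous_coinduced_dom.2 hc) fun x y ↦ ?_
    induction x using QuotientAddGroup.induction_on with | _ s
    induction y using QuotientAddGroup.induction_on with | _ t
    intro h
    obtain ⟨n, rfl⟩ := (hinj s t).1 h
    exact QuotientAddGroup.eq.2 (AddSubgroup.mem_zmultiples_iff.2 ⟨-n, by simp⟩)
  obtain ⟨g, hg⟩ := ContinuousMap.exists_extension' he
    (⟨hFper.lift, continuous_coinduced_dom.2 hF⟩ : C(AddCircle (1 : ℝ), ℂ))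
  exact ⟨g, g.continuous, fun t ↦ congrFun hg (t : AddCircle (1 : ℝ))⟩

/-- The complement of a simple closed curve in the plane has at most one bounded component. -/
theorem connectedComponentIn_eq_of_isBounded (hc : Continuous c)
    (hinj : ∀ s t, c s = c t ↔ ∃ n : ℤ, s = t + n) {p q : ℂ}
    (hp : p ∈ (Set.range c)ᶜ) (hq : q ∈ (Set.range c)ᶜ)
    (hbp : Bornology.IsBounded (connectedComponentIn (Set.range c)ᶜ p))
    (hbq : Bornology.IsBounded (connectedComponentIn (Set.range c)ᶜ q)) :
    connectedComponentIn (Set.range c)ᶜ p = connectedComponentIn (Set.range c)ᶜ q := by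
  have hper : Function.Periodic c 1 := fun t ↦ (hinj _ _).2 ⟨1, by simp⟩
  have hK := (isCompact_range_of_periodic hc hper).isClosed
  have key : ∀ p q : ℂ, p ∈ (Set.range c)ᶜ → q ∈ (Set.range c)ᶜ →
      Bornology.IsBounded (connectedComponentIn (Set.range c)ᶜ p) →
      connectedComponentIn (Set.range c)ᶜ p ≠ connectedComponentIn (Set.range c)ᶜ q →
      ∀ (m n : ℤ) (g : ℂ → ℂ), Continuous g →
      (∀ z ∈ Set.range c, Complex.exp (g z) = (z - p) ^ m * (z - q) ^ n) → m = 0 := by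
    intro p q hp hq hb hpq m n g hg hge
    have hqP : ∀ z ∈ closure (connectedComponentIn (Set.range c)ᶜ p), z - q ≠ 0 := by
      intro z hz h
      rw [sub_eq_zero] at h
      subst h
      exact hpq (connectedComponentIn_eq
        (closure_connectedComponentIn_inter_subset hK p ⟨hz, hq⟩))
    refine eq_zero_of_isBounded_connectedComponentIn hK hp hb (m := m)
      (G := fun z ↦ Complex.exp (g z) * (z - q) ^ (-n)) ?_ ?_ ?_
    · exact (by fun_prop : Continuous fun z ↦ Complex.exp (g z)).continuousOn.mul
        (ContinuousOn.zpow₀ (by fun_prop) _ fun z hz ↦ .inl (hqP z hz))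
    · exact fun z hz ↦ mul_ne_zero (Complex.exp_ne_zero _) (zpow_ne_zero _ (hqP z hz))
    · intro z hz
      have hzq : z - q ≠ 0 := fun h ↦ hq (by rwa [← sub_eq_zero.1 h])
      simp only [hge z hz]
      rw [mul_assoc, ← zpow_add₀ hzq, add_neg_cancel, zpow_zero, mul_one]
  by_contra hpq
  obtain ⟨a, F, hF, hFe, hFa⟩ := exists_continuous_log_comp_periodic hc hper hp
  obtain ⟨b, G, hG, hGe, hGb⟩ := exists_continuous_log_comp_periodic hc hper hq
  have comb : ∀ m n : ℤ, m * a + n * b = 0 → m = 0 ∧ n = 0 := by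
    intro m n hmn
    obtain ⟨g, hg, hgc⟩ := exists_continuous_extension_of_periodic hc hinj
      (F := fun t ↦ m * F t + n * G t) (by fun_prop) (fun t ↦ by
        have h1 : (m * a + n * b : ℂ) = 0 := by exact_mod_cast hmn
        simp only [hFa, hGb]
        linear_combination (2 * Real.pi * Complex.I) * h1)
    have hge : ∀ z ∈ Set.range c, Complex.exp (g z) = (z - p) ^ m * (z - q) ^ n := by
      rintro _ ⟨t, rfl⟩
      rw [hgc, Complex.exp_add, Complex.exp_int_mul, Complex.exp_int_mul, hFe, hGe]
    exact ⟨key p q hp hq hbp hpq m n g hg hge, key q p hq hp hbq (Ne.symm hpq) n m g hg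
      fun z hz ↦ by rw [hge z hz, mul_comm]⟩
  have hb0 := comb b (-a) (by ring)
  exact one_ne_zero (comb 1 0 (by simpa using hb0.2)).1

/-- If `c` runs from `b` to `a` then `(z - a) / (z - b)` has a continuous logarithm off `c`. -/
theorem exists_continuous_log_div (hc : Continuous c) {s t : ℝ} {U : Set ℂ}
    (hU : ∀ u ∈ Set.uIcc s t, c u ∉ U) :
    ∃ f : U → ℂ, Continuous f ∧ ∀ z : U, Complex.exp (f z) = (z - c t) / (z - c s) := by
  have hmem : ∀ x : unitInterval, s + x * (t - s) ∈ Set.uIcc s t := fun x ↦ by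
    have := (convex_uIcc s t).add_smul_sub_mem Set.left_mem_uIcc Set.right_mem_uIcc x.2
    simpa using this
  have hne : ∀ (u : Set.uIcc s t) (z : U), (z : ℂ) - c u ≠ 0 := fun u z h ↦
    hU u u.2 (by rw [← sub_eq_zero.1 h]; exact z.2)
  have hs : ∀ z : U, (z : ℂ) - c s ≠ 0 := hne ⟨s, Set.left_mem_uIcc⟩
  obtain ⟨g, hg, hge⟩ := exists_continuous_log_of_homotopy (A := U)
    (H := fun x ↦ ((x.2 : ℂ) - c (s + x.1 * (t - s))) / (x.2 - c s))
    (Continuous.div (by fun_prop) (by fun_prop) fun x ↦ hs x.2)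
    (fun x ↦ div_ne_zero (hne ⟨_, hmem x.1⟩ x.2) (hs x.2))
    (f := fun _ ↦ 0) continuous_const (fun z ↦ by simp [div_self (hs z)])
  exact ⟨g, hg, fun z ↦ by simpa using hge z⟩

theorem not_exists_log_div {a b : ℂ} (hab : a ≠ b) {f : ℂ → ℂ} (hf : ContinuousOn f {a, b}ᶜ)
    (h : ∀ z ∈ ({a, b} : Set ℂ)ᶜ, Complex.exp (f z) = (z - a) / (z - b)) : False := by
  have hab' : 0 < ‖a - b‖ := norm_pos_iff.2 (sub_ne_zero.2 hab)
  have hsph : ∀ z ∈ Metric.sphere a (‖a - b‖ / 2), z ∈ ({a, b} : Set ℂ)ᶜ ∧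
      (z - b) / (a - b) ∈ Complex.slitPlane := by
    intro z hz
    rw [mem_sphere_iff_norm] at hz
    have hw : ‖(z - a) / (a - b)‖ < 1 := by
      rw [norm_div, hz, div_lt_one hab']
      linarith
    have heq : (z - b) / (a - b) = 1 + (z - a) / (a - b) := by
      field_simp [sub_ne_zero.2 hab]
      ring
    have hsl : (z - b) / (a - b) ∈ Complex.slitPlane := by
      left
      have := (abs_le.1 (Complex.abs_re_le_norm ((z - a) / (a - b)))).1
      rw [heq, Complex.add_re, Complex.one_re]
      linarith
    refine ⟨?_, hsl⟩
    rintro (rfl | rfl)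
    · simp at hz
      linarith
    · simp at hsl
  refine one_ne_zero (eq_zero_of_exp_eq_zpow_on_sphere (half_pos hab') (p := a) (m := 1)
    (f := fun z ↦ f z + Complex.log ((z - b) / (a - b)) + Complex.log (a - b)) ?_ ?_)
  · refine ((hf.mono fun z hz ↦ (hsph z hz).1).add ?_).add continuousOn_const
    exact ContinuousOn.clog (by fun_prop) fun z hz ↦ (hsph z hz).2
  · intro z hz
    obtain ⟨h1, h2⟩ := hsph z hz
    have hzb : z - b ≠ 0 := fun h0 ↦ h1 (.inr (sub_eq_zero.1 h0))
    have hab0 := sub_ne_zero.2 hab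
    rw [Complex.exp_add, Complex.exp_add, h z h1, Complex.exp_log (Complex.slitPlane_ne_zero h2),
      Complex.exp_log hab0, zpow_one]
    field_simp

/-- A simple closed curve separates the plane. -/
theorem not_isPreconnected_compl_range (hc : Continuous c)
    (hinj : ∀ s t, c s = c t ↔ ∃ n : ℤ, s = t + n) : ¬ IsPreconnected (Set.range c)ᶜ := by
  classical
  intro hpre
  set U := (c '' Set.Icc 0 (1 / 2))ᶜ with hUdef
  set V := (c '' Set.Icc (1 / 2) 1)ᶜ with hVdef
  have hper : Function.Periodic c 1 := fun t ↦ (hinj _ _).2 ⟨1, by simp⟩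
  have hUo : IsOpen U := (isCompact_Icc.image hc).isClosed.isOpen_compl
  have hVo : IsOpen V := (isCompact_Icc.image hc).isClosed.isOpen_compl
  have hUV : U ∩ V = (Set.range c)ᶜ := compl_image_inter_compl_image hinj
  have h10 : c 1 = c 0 := by simpa using hper 0
  have hcover : ({c 0, c (1 / 2)} : Set ℂ)ᶜ ⊆ U ∪ V := compl_pair_subset_union hinj
  obtain ⟨f, hf, hfe⟩ := exists_continuous_log_div hc (s := 1 / 2) (t := 0) (U := U)
    (fun u hu h ↦ h ⟨u, by rwa [Set.uIcc_comm, Set.uIcc_of_le (by norm_num)] at hu, rfl⟩)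
  obtain ⟨g, hg, hge⟩ := exists_continuous_log_div hc (s := 1 / 2) (t := 1) (U := V)
    (fun u hu h ↦ h ⟨u, by rwa [Set.uIcc_of_le (by norm_num)] at hu, rfl⟩)
  rw [h10] at hge
  have : PreconnectedSpace ↥(U ∩ V) := isPreconnected_iff_preconnectedSpace.1 (hUV ▸ hpre)
  obtain ⟨n, hn⟩ := exists_int_of_exp_eq_exp (X := ↥(U ∩ V)) (f := fun z ↦ f ⟨z, z.2.1⟩)
    (g := fun z ↦ g ⟨z, z.2.2⟩) (by fun_prop) (by fun_prop) (fun z ↦ by rw [hfe, hge])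
  set L : ℂ → ℂ := fun z ↦ if h : z ∈ U then f ⟨z, h⟩ else
    if h : z ∈ V then g ⟨z, h⟩ + n * (2 * Real.pi * Complex.I) else 0 with hL
  have hLU : ∀ z : U, L z = f z := fun z ↦ by simp [hL]
  have hLV : ∀ z : V, L z = g z + n * (2 * Real.pi * Complex.I) := fun z ↦ by
    by_cases hz : (z : ℂ) ∈ U
    · simpa [hL, hz] using hn ⟨z, hz, z.2⟩
    · simp [hL, hz]
  have hLcU : ContinuousOn L U := by
    rw [continuousOn_iff_continuous_domRestrict]
    exact hf.congr fun z ↦ (hLU z).symm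
  have hLcV : ContinuousOn L V := by
    rw [continuousOn_iff_continuous_domRestrict]
    exact (hg.add continuous_const).congr fun z ↦ (hLV z).symm
  refine not_exists_log_div (a := c 0) (b := c (1 / 2)) (fun h ↦ ?_)
    ((hLcU.union_of_isOpen hLcV hUo hVo).mono hcover) fun z hz ↦ ?_
  · obtain ⟨n, hn⟩ := (hinj _ _).1 h
    have h2 : ((2 * n : ℤ) : ℝ) = (-1 : ℤ) := by push_cast; linarith
    have h3 : 2 * n = -1 := by exact_mod_cast h2
    omega
  · rcases hcover hz with hz | hz
    · rw [hLU ⟨z, hz⟩, hfe]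
    · rw [hLV ⟨z, hz⟩, Complex.exp_add, hge]
      simp [Complex.exp_int_mul_two_pi_mul_I]

/-- Every component of the complement of a simple closed curve is adherent to the whole curve. -/
theorem range_subset_closure_connectedComponentIn (hc : Continuous c)
    (hinj : ∀ s t, c s = c t ↔ ∃ n : ℤ, s = t + n) {x : ℂ} (hx : x ∈ (Set.range c)ᶜ) :
    Set.range c ⊆ closure (connectedComponentIn (Set.range c)ᶜ x) := by
  have hper : Function.Periodic c 1 := fun t ↦ (hinj _ _).2 ⟨1, by simp⟩
  have hK := (isCompact_range_of_periodic hc hper).isClosed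
  set P := connectedComponentIn (Set.range c)ᶜ x with hP
  rintro _ ⟨t₀, rfl⟩
  by_contra ht₀
  obtain ⟨ε, hε, hball⟩ := Metric.isOpen_iff.1 (isClosed_closure.isOpen_compl.preimage hc) t₀ ht₀
  have hball' : ∀ u, |u - t₀| < ε → c u ∉ closure P := fun u hu ↦ hball (by
    rwa [Metric.mem_ball, Real.dist_eq])
  set δ := min (ε / 2) (1 / 3) with hδ
  have hδ0 : 0 < δ := by positivity
  have hδε : δ < ε := (min_le_left _ _).trans_lt (by linarith)
  have hδ3 : δ ≤ 1 / 3 := min_le_right _ _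
  have hA := isPreconnected_compl_arc hc (s := t₀ + δ) (t := t₀ + 1 - δ) (by linarith) (by
    intro u hu v hv huv
    obtain ⟨n, hn⟩ := (hinj _ _).1 huv
    have h1 : (-1 : ℝ) < n := by linarith [hu.1, hv.2]
    have h2 : (n : ℝ) < 1 := by linarith [hu.2, hv.1]
    have h3 : -1 < n := by exact_mod_cast h1
    have h4 : n < 1 := by exact_mod_cast h2
    obtain rfl : n = 0 := by omega
    simpa using hn)
  set A := c '' Set.Icc (t₀ + δ) (t₀ + 1 - δ) with hAdef
  have hAK : A ⊆ Set.range c := Set.image_subset_range _ _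
  have hclA : closure P ∩ Set.range c ⊆ A := by
    rintro _ ⟨hz, t, rfl⟩
    have hu0 := Int.fract_nonneg (t - t₀)
    have hu1 := Int.fract_lt_one (t - t₀)
    set u := t₀ + Int.fract (t - t₀) with hu
    have hcu : c t = c u := (hinj _ _).2 ⟨⌊t - t₀⌋, by
      rw [hu]; linarith [Int.fract_add_floor (t - t₀)]⟩
    have hcu' : c t = c (u - 1) := by rw [hcu, hper.sub_eq]
    refine ⟨u, ⟨?_, ?_⟩, hcu.symm⟩
    · by_contra! h
      refine hball' u ?_ (hcu ▸ hz)
      rw [abs_lt]; constructor <;> linarith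
    · by_contra! h
      refine hball' (u - 1) ?_ (hcu' ▸ hz)
      rw [abs_lt]; constructor <;> linarith
  have hsub : Aᶜ ⊆ P := by
    refine hA.subset_of_closure_inter_subset hK.isOpen_compl.connectedComponentIn
      ⟨x, fun h ↦ hx (hAK h), mem_connectedComponentIn hx⟩ ?_
    rintro z ⟨hz, hzA⟩
    by_cases hzK : z ∈ Set.range c
    · exact absurd (hclA ⟨hz, hzK⟩) hzA
    · exact closure_connectedComponentIn_inter_subset hK x ⟨hz, hzK⟩
  have hPK : P = (Set.range c)ᶜ :=
    (connectedComponentIn_subset _ _).antisymm ((Set.compl_subset_compl.2 hAK).trans hsub)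
  exact not_isPreconnected_compl_range hc hinj (hPK ▸ isPreconnected_connectedComponentIn)

/-- The **Jordan curve theorem** in the plane. -/
theorem exists_components_compl_range (hc : Continuous c)
    (hinj : ∀ s t, c s = c t ↔ ∃ n : ℤ, s = t + n) :
    ∃ B W : Set ℂ, IsOpen B ∧ IsOpen W ∧ IsConnected B ∧ IsConnected W ∧ Disjoint B W ∧
      B ∪ W = (Set.range c)ᶜ ∧ Bornology.IsBounded B ∧
      Set.range c ⊆ closure B ∧ Set.range c ⊆ closure W := by
  have hper : Function.Periodic c 1 := fun t ↦ (hinj _ _).2 ⟨1, by simp⟩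
  have hK := isCompact_range_of_periodic hc hper
  have hO := hK.isClosed.isOpen_compl
  have hnot := not_isPreconnected_compl_range hc hinj
  obtain ⟨x, hx, hxb⟩ : ∃ x ∈ (Set.range c)ᶜ,
      Bornology.IsBounded (connectedComponentIn (Set.range c)ᶜ x) := by
    by_contra! h
    exact hnot (isPreconnected_compl_of_forall_not_isBounded hK h)
  obtain ⟨y, hy, hyb⟩ : ∃ y ∈ (Set.range c)ᶜ,
      ¬ Bornology.IsBounded (connectedComponentIn (Set.range c)ᶜ y) := by
    by_contra! h
    refine hnot (isPreconnected_of_forall x fun z hz ↦ ⟨connectedComponentIn (Set.range c)ᶜ x,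
      connectedComponentIn_subset _ _, mem_connectedComponentIn hx, ?_,
      isPreconnected_connectedComponentIn⟩)
    rw [connectedComponentIn_eq_of_isBounded hc hinj hx hz hxb (h z hz)]
    exact mem_connectedComponentIn hz
  refine ⟨connectedComponentIn (Set.range c)ᶜ x, connectedComponentIn (Set.range c)ᶜ y,
    hO.connectedComponentIn, hO.connectedComponentIn, isConnected_connectedComponentIn_iff.2 hx,
    isConnected_connectedComponentIn_iff.2 hy, ?_, ?_, hxb,
    range_subset_closure_connectedComponentIn hc hinj hx,
    range_subset_closure_connectedComponentIn hc hinj hy⟩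
  · refine Set.disjoint_left.2 fun z hzx hzy ↦ hyb ?_
    rwa [connectedComponentIn_eq hzy, ← connectedComponentIn_eq hzx]
  · refine (Set.union_subset (connectedComponentIn_subset _ _)
      (connectedComponentIn_subset _ _)).antisymm fun z hz ↦ ?_
    by_cases hzb : Bornology.IsBounded (connectedComponentIn (Set.range c)ᶜ z)
    · left
      rw [connectedComponentIn_eq_of_isBounded hc hinj hx hz hxb hzb]
      exact mem_connectedComponentIn hz
    · right
      rw [connectedComponentIn_eq_of_not_isBounded hK hyb hzb]
      exact mem_connectedComponentIn hz

end ClosedCurve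

section TwoPieces

variable {X : Type*} [TopologicalSpace X] {P Q S : Set X}

theorem connectedComponentIn_eq_of_union_eq (hP : IsOpen P) (hQ : IsOpen Q) (hPc : IsPreconnected P)
    (hd : Disjoint P Q) (hS : P ∪ Q = S) {x : X} (hx : x ∈ P) : connectedComponentIn S x = P := by
  subst hS
  exact (isPreconnected_connectedComponentIn.subset_left_of_subset_union hP hQ hd
    (connectedComponentIn_subset _ _)
    ⟨x, mem_connectedComponentIn (.inl hx), hx⟩).antisymm
    (hPc.subset_connectedComponentIn hx Set.subset_union_left)

theorem closure_sdiff_eq_compl_union (hQ : IsOpen Q) (hd : Disjoint P Q)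
    (hcl : (P ∪ Q)ᶜ ⊆ closure P) : closure P \ P = (P ∪ Q)ᶜ := by
  refine Set.Subset.antisymm (fun z hz h ↦ h.elim hz.2 fun hzQ ↦ ?_)
    fun z hz ↦ ⟨hcl hz, fun h ↦ hz (.inl h)⟩
  exact Set.disjoint_left.1 (hd.closure_left hQ) hz.1 hzQ

end TwoPieces

section Sphere

local notation "𝕊²" => Metric.sphere (0 : EuclideanSpace ℝ (Fin 3)) 1

theorem exists_isOpenEmbedding_sphere (v : 𝕊²) :
    ∃ φ : ℂ → 𝕊², Topology.IsOpenEmbedding φ ∧ Set.range φ = {v}ᶜ := by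
  have : Fact (Module.finrank ℝ (EuclideanSpace ℝ (Fin 3)) = 2 + 1) := ⟨by simp⟩
  have hv : ‖(v : EuclideanSpace ℝ (Fin 3))‖ = 1 := by simp
  let e : ℂ ≃L[ℝ] (Submodule.span ℝ {(v : EuclideanSpace ℝ (Fin 3))})ᗮ :=
    ContinuousLinearEquiv.ofFinrankEq (by
      rw [Complex.finrank_real_complex,
        Submodule.finrank_orthogonal_span_singleton (n := 2) (by rintro h; simp [h] at hv)])
  refine ⟨(stereographic hv).symm ∘ e,
    (isOpenEmbedding_stereographic_symm hv).comp e.toHomeomorph.isOpenEmbedding, ?_⟩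
  rw [e.surjective.range_comp, range_stereographic_symm hv v.2]

theorem exists_periodic_parametrization {C : Set 𝕊²} (e : C ≃ₜ Metric.sphere (0 : ℂ) 1) :
    ∃ γ : ℝ → 𝕊², Continuous γ ∧ (∀ s t, γ s = γ t ↔ ∃ n : ℤ, s = t + n) ∧ Set.range γ = C := by
  have hmem : ∀ t : ℝ, Complex.exp ((2 * Real.pi * t : ℝ) * Complex.I) ∈
      Metric.sphere (0 : ℂ) 1 := fun t ↦ by
    rw [mem_sphere_zero_iff_norm, Complex.norm_exp_ofReal_mul_I]
  refine ⟨fun t ↦ e.symm ⟨_, hmem t⟩, by fun_prop, fun s t ↦ ?_, ?_⟩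
  · rw [← Subtype.ext_iff, e.symm.injective.eq_iff, Subtype.mk.injEq,
      Complex.exp_eq_exp_iff_exists_int]
    refine exists_congr fun n ↦ ?_
    have hpi : (2 * Real.pi * Complex.I : ℂ) ≠ 0 := Complex.two_pi_I_ne_zero
    rw [← Complex.ofReal_inj]
    push_cast
    constructor <;> intro h
    · refine mul_left_cancel₀ hpi ?_
      linear_combination h
    · rw [h]; ring
  · refine Set.Subset.antisymm (Set.range_subset_iff.2 fun t ↦ (e.symm _).2) fun x hx ↦ ?_
    refine ⟨Complex.arg (e ⟨x, hx⟩) / (2 * Real.pi), ?_⟩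
    have h : (⟨_, hmem (Complex.arg (e ⟨x, hx⟩) / (2 * Real.pi))⟩ : Metric.sphere (0 : ℂ) 1) =
        e ⟨x, hx⟩ := by
      refine Subtype.ext ?_
      have h1 := Complex.norm_mul_exp_arg_mul_I (e ⟨x, hx⟩ : ℂ)
      rw [mem_sphere_zero_iff_norm.1 (e ⟨x, hx⟩).2] at h1
      have h2 : 2 * Real.pi * (Complex.arg (e ⟨x, hx⟩) / (2 * Real.pi)) =
          Complex.arg (e ⟨x, hx⟩) := by field_simp
      simpa only [h2, Complex.ofReal_one, one_mul] using h1
    simp only [h, e.symm_apply_apply]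

theorem range_ne_univ_of_simple_closed {γ : ℝ → 𝕊²} (hγ : Continuous γ)
    (hinj : ∀ s t, γ s = γ t ↔ ∃ n : ℤ, s = t + n) : Set.range γ ≠ Set.univ := by
  intro hsurj
  refine not_isPreconnected_compl_pair hγ hinj hsurj ?_
  obtain ⟨φ, hφ, hφr⟩ := exists_isOpenEmbedding_sphere (γ 0)
  have hne : γ (1 / 2) ≠ γ 0 := fun h ↦ by
    obtain ⟨n, hn⟩ := (hinj _ _).1 h
    have h2 : ((2 * n : ℤ) : ℝ) = (1 : ℤ) := by push_cast; linarith
    have h3 : 2 * n = 1 := by exact_mod_cast h2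
    omega
  obtain ⟨a, ha⟩ : γ (1 / 2) ∈ Set.range φ := by rw [hφr]; exact hne
  have heq : ({γ 0, γ (1 / 2)}ᶜ : Set 𝕊²) = φ '' {a}ᶜ := by
    rw [Set.image_compl_eq_range_sdiff_image hφ.injective, hφr, Set.image_singleton, ha,
      Set.sdiff_eq, ← Set.compl_union, Set.singleton_union]
  rw [heq]
  exact (isConnected_compl_singleton_of_one_lt_rank (by simp) a).isPreconnected.image _
    hφ.continuous.continuousOn

end Sphere

/-- Jordan Curve Theorem on the sphere: the complement of a simple closed curve in `S²`
has exactly two connected components, and each component has the curve as its frontier. -/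
theorem jordan_curve
    (C : Set (Metric.sphere (0 : EuclideanSpace ℝ (Fin 3)) 1))
    (hC : Nonempty (C ≃ₜ Metric.sphere (0 : ℂ) 1)) :
    ({P : Set (Metric.sphere (0 : EuclideanSpace ℝ (Fin 3)) 1) |
        ∃ x ∈ Cᶜ, P = connectedComponentIn Cᶜ x}).ncard = 2 ∧
    ∀ x ∈ Cᶜ, closure (connectedComponentIn Cᶜ x) \ connectedComponentIn Cᶜ x = C := by
  obtain ⟨γ, hγ, hinj, rfl⟩ := exists_periodic_parametrization hC.some
  obtain ⟨N, hN⟩ := (Set.ne_univ_iff_exists_notMem _).1 (range_ne_univ_of_simple_closed hγ hinj)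
  obtain ⟨φ, hφ, hφr⟩ := exists_isOpenEmbedding_sphere N
  have hγφ : ∀ t, γ t ∈ Set.range φ := fun t ↦ by
    rw [hφr]
    exact fun h ↦ hN ⟨t, h⟩
  choose c hc using hγφ
  have hcγ : φ ∘ c = γ := funext hc
  have hcc : Continuous c := hφ.isInducing.continuous_iff.2 (hcγ ▸ hγ)
  have hrange : Set.range γ = φ '' Set.range c := by rw [← hcγ, Set.range_comp]
  have hcinj : ∀ s t, c s = c t ↔ ∃ n : ℤ, s = t + n := fun s t ↦ by
    rw [← hinj, ← hc, ← hc, hφ.injective.eq_iff]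
  obtain ⟨B, W, hBo, hWo, hBc, hWc, hBW, hBWu, hBb, hKB, hKW⟩ :=
    exists_components_compl_range hcc hcinj
  have hNφ : ∀ T : Set ℂ, N ∉ φ '' T := fun T h ↦ by
    have := Set.image_subset_range φ T h
    rw [hφr] at this
    exact this rfl
  have hcomp : IsCompact Wᶜ := by
    have hW : Wᶜ = B ∪ Set.range c := by
      rw [← compl_inj_iff, compl_compl, Set.compl_union, ← hBWu, Set.inter_union_distrib_left,
        Set.compl_inter_self, Set.empty_union, eq_comm, Set.inter_eq_right]
      exact hBW.subset_compl_left
    refine Metric.isCompact_of_isClosed_isBounded hWo.isClosed_compl ?_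
    rw [hW]
    exact hBb.union
      (isCompact_range_of_periodic hcc fun t ↦ (hcinj _ _).2 ⟨1, by simp⟩).isBounded
  have hQ : insert N (φ '' W) = (φ '' Wᶜ)ᶜ := by
    rw [Set.image_compl_eq_range_sdiff_image hφ.injective, hφr, Set.compl_sdiff, compl_compl,
      Set.union_comm, Set.singleton_union]
  have hPo : IsOpen (φ '' B) := hφ.isOpenMap _ hBo
  have hQo : IsOpen (insert N (φ '' W)) := by
    rw [hQ]
    exact (hcomp.image hφ.continuous).isClosed.isOpen_compl
  have hNcl : N ∈ closure (φ '' W) := by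
    by_contra hNW
    have hsub : closure (φ '' W) ⊆ Set.range φ := by
      rw [hφr]
      exact fun z hz h ↦ hNW (h ▸ hz)
    have hWb : Bornology.IsBounded W :=
      ((hφ.isInducing.isCompact_preimage' isClosed_closure.isCompact hsub).isBounded).subset
        fun z hz ↦ subset_closure (Set.mem_image_of_mem φ hz)
    refine NormedSpace.unbounded_univ ℝ ℂ ?_
    rw [← Set.union_compl_self W]
    exact hWb.union hcomp.isBounded
  have hPc : IsPreconnected (φ '' B) := hBc.isPreconnected.image _ hφ.continuous.continuousOn
  have hQc : IsPreconnected (insert N (φ '' W)) :=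
    (hWc.isPreconnected.image _ hφ.continuous.continuousOn).subset_closure
      (Set.subset_insert _ _) (Set.insert_subset hNcl subset_closure)
  have hd : Disjoint (φ '' B) (insert N (φ '' W)) := by
    rw [Set.disjoint_insert_right]
    exact ⟨hNφ B, (Set.disjoint_image_iff hφ.injective).2 hBW⟩
  have hu : φ '' B ∪ insert N (φ '' W) = (Set.range γ)ᶜ := by
    rw [hrange, ← compl_compl (Set.range c), Set.image_compl_eq_range_sdiff_image hφ.injective,
      ← hBWu, hφr, Set.compl_sdiff, compl_compl, Set.image_union, Set.union_insert,
      Set.union_comm _ {N}, Set.singleton_union]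
  have hclP : Set.range γ ⊆ closure (φ '' B) := by
    rw [hrange]
    exact (Set.image_mono hKB).trans (image_closure_subset_closure_image hφ.continuous)
  have hclQ : Set.range γ ⊆ closure (insert N (φ '' W)) := by
    rw [hrange]
    exact ((Set.image_mono hKW).trans (image_closure_subset_closure_image hφ.continuous)).trans
      (closure_mono (Set.subset_insert _ _))
  have hu' : insert N (φ '' W) ∪ φ '' B = (Set.range γ)ᶜ := by rw [Set.union_comm, hu]
  have hcP := fun x ↦ connectedComponentIn_eq_of_union_eq hPo hQo hPc hd hu (x := x)
  have hcQ := fun x ↦ connectedComponentIn_eq_of_union_eq hQo hPo hQc hd.symm hu' (x := x)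
  obtain ⟨b, hb⟩ := hBc.nonempty.image φ
  have hNQ : N ∈ insert N (φ '' W) := Set.mem_insert _ _
  constructor
  · have hset : {P | ∃ x ∈ (Set.range γ)ᶜ, P = connectedComponentIn (Set.range γ)ᶜ x} =
        {φ '' B, insert N (φ '' W)} := by
      ext P
      constructor
      · rintro ⟨x, hx, rfl⟩
        rw [← hu] at hx
        exact hx.imp (hcP x) (hcQ x)
      · rintro (rfl | rfl)
        · exact ⟨b, hu ▸ .inl hb, (hcP b hb).symm⟩
        · exact ⟨N, hu ▸ .inr hNQ, (hcQ N hNQ).symm⟩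
    rw [hset, Set.ncard_pair]
    intro h
    exact hNφ B (h ▸ hNQ)
  · intro x hx
    rw [← hu] at hx
    rcases hx with hx | hx
    · rw [hcP x hx, closure_sdiff_eq_compl_union hQo hd (by rwa [hu, compl_compl]), hu, compl_compl]
    · rw [hcQ x hx, closure_sdiff_eq_compl_union hPo hd.symm (by rwa [hu', compl_compl]), hu',
        compl_compl]
end
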